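/- arXiv:math-ph/0512095 — 2 statements merged into one kernel-verified Lean document; each statement's English description precedes it below -/
import Mathlib

section
/- For the family B_n(Λ) with n = 5, i.e., the set {e_i ± e_j (1 ≤ i < j ≤ 5), Λe_i (1 ≤ i ≤ 5), M(e_1 ± e_2 ± e_3 ± e_4 ± e_5) (all sign choices)} in ℝ⁵ with M ≠ 0, this set is a ∨-system if and only if M² = 1 and Λ² = 6. -/
open Matrix
open scoped Classical

/-- The Gram matrix `G^A = Σ_i A_i ⊗ A_i` of a finite family of covectors on `ℝⁿ`. -/
noncomputable def gram {n : ℕ} {ι : Type*} [Fintype ι] (A : ι → Fin n → ℝ) :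
    Matrix (Fin n) (Fin n) ℝ := ∑ i, vecMulVec (A i) (A i)

/-- The vector `α^∨` dual to the covector `α` via the Gram form `G^A`. -/
noncomputable def vee {n : ℕ} {ι : Type*} [Fintype ι] (A : ι → Fin n → ℝ)
    (α : Fin n → ℝ) : Fin n → ℝ := (gram A)⁻¹ *ᵥ α

/-- `A` is a ∨-system: a finite spanning family of covectors with non-degenerate Gram
form such that for every two-dimensional plane `Pl ⊂ V*` and every member `A_i ∈ Pl`,
the vector `Σ_{A_j ∈ Pl} A_j(A_i^∨) • A_j^∨` is proportional to `A_i^∨`. -/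
def IsVeeSystem {n : ℕ} {ι : Type*} [Fintype ι] (A : ι → Fin n → ℝ) : Prop :=
  Submodule.span ℝ (Set.range A) = ⊤ ∧ IsUnit (gram A) ∧
    ∀ Pl : Submodule ℝ (Fin n → ℝ), Module.finrank ℝ Pl = 2 →
      ∀ i, A i ∈ Pl → ∃ lam : ℝ,
        ∑ j ∈ Finset.univ.filter (fun j => A j ∈ Pl),
          (A j ⬝ᵥ vee A (A i)) • vee A (A j) = lam • vee A (A i)

/-- The `F₅`-type family: covectors `e_i ± e_j` (`1 ≤ i < j ≤ 5`), `Λ e_i`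
(`1 ≤ i ≤ 5`), and `M(e_1 ± e_2 ± e_3 ± e_4 ± e_5)` (all sign choices, taken up to
overall sign by fixing the sign of `e_1` to be `+`). -/
def F5system (Λ M : ℝ) :
    (({p : Fin 5 × Fin 5 // p.1 < p.2} × Bool) ⊕ Fin 5 ⊕
      {ε : Fin 5 → Bool // ε 0 = true}) → Fin 5 → ℝ :=
  fun k => match k with
  | Sum.inl (p, b) => fun t =>
      (if t = p.1.1 then 1 else 0) + (if t = p.1.2 then (if b then 1 else -1) else 0)
  | Sum.inr (Sum.inl i) => fun t => if t = i then Λ else 0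
  | Sum.inr (Sum.inr ε) => fun t => M * (if ε.1 t then 1 else -1)

/-- Integer vectors of length five. -/
abbrev IntVec := ℤ × ℤ × ℤ × ℤ × ℤ

namespace IntVec

/-- The Euclidean pairing of integer vectors. -/
def dot (u v : IntVec) : ℤ :=
  u.1 * v.1 + u.2.1 * v.2.1 + u.2.2.1 * v.2.2.1 + u.2.2.2.1 * v.2.2.2.1 +
    u.2.2.2.2 * v.2.2.2.2

/-- The Gram determinant of two integer vectors. -/
def gramDet₂ (u v : IntVec) : ℤ := dot u u * dot v v - dot u v * dot u v

/-- The Gram determinant of three integer vectors. -/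
def gramDet₃ (u v w : IntVec) : ℤ :=
  dot w w * gramDet₂ u v - (dot w u * dot w u * dot v v -
    2 * (dot w u * dot w v * dot u v) + dot w v * dot w v * dot u u)

/-- The expression `(u · u)(s · v) - (u · v)(s · u)` for `s = (w · u) w`. For `s` in the plane
spanned by `u` and `v`, it vanishes exactly when `s` is proportional to `u`. -/
def defect (u v w : IntVec) : ℤ := dot w u * (dot u u * dot w v - dot u v * dot w u)

end IntVec

/-- The directions of the covectors of `F5system`. -/
def F5directions : List IntVec :=
  [(1, 1, 0, 0, 0), (1, -1, 0, 0, 0), (1, 0, 1, 0, 0), (1, 0, -1, 0, 0),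
   (1, 0, 0, 1, 0), (1, 0, 0, -1, 0), (1, 0, 0, 0, 1), (1, 0, 0, 0, -1),
   (0, 1, 1, 0, 0), (0, 1, -1, 0, 0), (0, 1, 0, 1, 0), (0, 1, 0, -1, 0),
   (0, 1, 0, 0, 1), (0, 1, 0, 0, -1), (0, 0, 1, 1, 0), (0, 0, 1, -1, 0),
   (0, 0, 1, 0, 1), (0, 0, 1, 0, -1), (0, 0, 0, 1, 1), (0, 0, 0, 1, -1),
   (1, 0, 0, 0, 0), (0, 1, 0, 0, 0), (0, 0, 1, 0, 0), (0, 0, 0, 1, 0),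
   (0, 0, 0, 0, 1), (1, 1, 1, 1, 1), (1, 1, 1, 1, -1), (1, 1, 1, -1, 1),
   (1, 1, 1, -1, -1), (1, 1, -1, 1, 1), (1, 1, -1, 1, -1), (1, 1, -1, -1, 1),
   (1, 1, -1, -1, -1), (1, -1, 1, 1, 1), (1, -1, 1, 1, -1), (1, -1, 1, -1, 1),
   (1, -1, 1, -1, -1), (1, -1, -1, 1, 1), (1, -1, -1, 1, -1), (1, -1, -1, -1, 1),
   (1, -1, -1, -1, -1)]

/-- The integer direction of a member of `F5system`. -/
def F5dir : (({p : Fin 5 × Fin 5 // p.1 < p.2} × Bool) ⊕ Fin 5 ⊕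
    {ε : Fin 5 → Bool // ε 0 = true}) → IntVec :=
  fun k =>
    let f : Fin 5 → ℤ := match k with
      | Sum.inl (p, b) => fun t =>
          (if t = p.1.1 then 1 else 0) + (if t = p.1.2 then (if b then 1 else -1) else 0)
      | Sum.inr (Sum.inl i) => fun t => if t = i then 1 else 0
      | Sum.inr (Sum.inr ε) => fun t => if ε.1 t then 1 else -1
    (f 0, f 1, f 2, f 3, f 4)

theorem map_F5dir_univ : Finset.univ.val.map F5dir = (F5directions : Multiset IntVec) := by
  decide +kernel

theorem F5directions_sum_defect_eq_zero : ∀ u ∈ F5directions, ∀ v ∈ F5directions, IntVec.gramDet₂ u v ≠ 0 →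
    ((F5directions.filter fun w => IntVec.gramDet₃ u v w = 0).map fun w =>
      (if IntVec.dot w w = 1 then 6 else 1) * IntVec.defect u v w).sum = 0 := by
  decide +kernel

section Planes

variable {n : ℕ}

theorem linearIndependent_pair_of_gram_det_ne_zero {u v : Fin n → ℝ}
    (huv : (u ⬝ᵥ u) * (v ⬝ᵥ v) - (u ⬝ᵥ v) * (u ⬝ᵥ v) ≠ 0) : LinearIndependent ℝ ![u, v] := by
  rw [LinearIndependent.pair_iff]
  intro s t hst
  have h1 : s * (u ⬝ᵥ u) + t * (u ⬝ᵥ v) = 0 := by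
    simpa [dotProduct_add, dotProduct_smul] using congrArg (u ⬝ᵥ ·) hst
  have h2 : s * (u ⬝ᵥ v) + t * (v ⬝ᵥ v) = 0 := by
    simpa [dotProduct_add, dotProduct_smul, dotProduct_comm v u] using congrArg (v ⬝ᵥ ·) hst
  constructor
  · refine (mul_eq_zero.1 ?_).resolve_right huv
    linear_combination (v ⬝ᵥ v) * h1 - (u ⬝ᵥ v) * h2
  · refine (mul_eq_zero.1 ?_).resolve_right huv
    linear_combination (u ⬝ᵥ u) * h2 - (u ⬝ᵥ v) * h1

theorem finrank_span_pair_of_gram_det_ne_zero {u v : Fin n → ℝ}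
    (huv : (u ⬝ᵥ u) * (v ⬝ᵥ v) - (u ⬝ᵥ v) * (u ⬝ᵥ v) ≠ 0) :
    Module.finrank ℝ (Submodule.span ℝ {u, v}) = 2 := by
  have h := finrank_span_eq_card (linearIndependent_pair_of_gram_det_ne_zero huv)
  rwa [Matrix.range_cons_cons_empty, Fintype.card_fin] at h

theorem mem_plane_iff_exists_smul_add_smul {Pl : Submodule ℝ (Fin n → ℝ)}
    (hPl : Module.finrank ℝ Pl = 2) {u v w : Fin n → ℝ} (hu : u ∈ Pl) (hv : v ∈ Pl)
    (huv : (u ⬝ᵥ u) * (v ⬝ᵥ v) - (u ⬝ᵥ v) * (u ⬝ᵥ v) ≠ 0) :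
    w ∈ Pl ↔ ∃ a b : ℝ, a • u + b • v = w := by
  have hspan : Submodule.span ℝ {u, v} = Pl :=
    Submodule.eq_of_le_of_finrank_eq
      (Submodule.span_le.2 (by simp [Set.insert_subset_iff, hu, hv]))
      ((finrank_span_pair_of_gram_det_ne_zero huv).trans hPl.symm)
  rw [← hspan, Submodule.mem_span_pair]

theorem mem_plane_iff_gram_det_eq_zero {Pl : Submodule ℝ (Fin n → ℝ)}
    (hPl : Module.finrank ℝ Pl = 2) {u v w : Fin n → ℝ} (hu : u ∈ Pl) (hv : v ∈ Pl)
    (huv : (u ⬝ᵥ u) * (v ⬝ᵥ v) - (u ⬝ᵥ v) * (u ⬝ᵥ v) ≠ 0) :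
    w ∈ Pl ↔ (w ⬝ᵥ w) * ((u ⬝ᵥ u) * (v ⬝ᵥ v) - (u ⬝ᵥ v) * (u ⬝ᵥ v)) -
      ((w ⬝ᵥ u) * (w ⬝ᵥ u) * (v ⬝ᵥ v) - 2 * ((w ⬝ᵥ u) * (w ⬝ᵥ v) * (u ⬝ᵥ v)) +
        (w ⬝ᵥ v) * (w ⬝ᵥ v) * (u ⬝ᵥ u)) = 0 := by
  rw [mem_plane_iff_exists_smul_add_smul hPl hu hv huv]
  constructor
  · rintro ⟨a, b, rfl⟩
    simp only [dotProduct_add, add_dotProduct, dotProduct_smul, smul_dotProduct, smul_eq_mul,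
      dotProduct_comm v u]
    ring
  · intro h
    set g := (u ⬝ᵥ u) * (v ⬝ᵥ v) - (u ⬝ᵥ v) * (u ⬝ᵥ v) with hg
    set p := (w ⬝ᵥ u) * (v ⬝ᵥ v) - (w ⬝ᵥ v) * (u ⬝ᵥ v) with hp
    set q := (w ⬝ᵥ v) * (u ⬝ᵥ u) - (w ⬝ᵥ u) * (u ⬝ᵥ v) with hq
    have h0 : g • w - p • u - q • v = 0 := by
      rw [← dotProduct_self_eq_zero]
      simp only [dotProduct_sub, sub_dotProduct, dotProduct_smul, smul_dotProduct, smul_eq_mul,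
        dotProduct_comm v u, dotProduct_comm u w, dotProduct_comm v w]
      linear_combination g * h
    refine ⟨g⁻¹ * p, g⁻¹ * q, ?_⟩
    rw [mul_smul, mul_smul, ← smul_add, inv_smul_eq_iff₀ huv]
    rw [sub_sub, sub_eq_zero] at h0
    exact h0.symm

theorem exists_eq_smul_iff_of_mem_plane {Pl : Submodule ℝ (Fin n → ℝ)}
    (hPl : Module.finrank ℝ Pl = 2) {u v s : Fin n → ℝ} (hu : u ∈ Pl) (hv : v ∈ Pl)
    (hs : s ∈ Pl) (huv : (u ⬝ᵥ u) * (v ⬝ᵥ v) - (u ⬝ᵥ v) * (u ⬝ᵥ v) ≠ 0) :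
    (∃ lam : ℝ, s = lam • u) ↔ (u ⬝ᵥ u) * (s ⬝ᵥ v) - (u ⬝ᵥ v) * (s ⬝ᵥ u) = 0 := by
  constructor
  · rintro ⟨lam, rfl⟩
    simp only [smul_dotProduct, smul_eq_mul]
    ring
  · obtain ⟨a, b, rfl⟩ := (mem_plane_iff_exists_smul_add_smul hPl hu hv huv).1 hs
    intro h
    simp only [add_dotProduct, smul_dotProduct, smul_eq_mul, dotProduct_comm v u] at h
    have hb : b = 0 := by
      refine (mul_eq_zero.1 ?_).resolve_right huv
      linear_combination h
    exact ⟨a, by simp [hb]⟩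

theorem eq_smul_of_gram_det_eq_zero {u w : Fin n → ℝ} (hu : u ⬝ᵥ u ≠ 0)
    (h : (u ⬝ᵥ u) * (w ⬝ᵥ w) - (u ⬝ᵥ w) * (u ⬝ᵥ w) = 0) :
    w = ((u ⬝ᵥ w) / (u ⬝ᵥ u)) • u := by
  have h0 : (u ⬝ᵥ u) • w - (u ⬝ᵥ w) • u = 0 := by
    rw [← dotProduct_self_eq_zero]
    simp only [dotProduct_sub, sub_dotProduct, dotProduct_smul, smul_dotProduct, smul_eq_mul,
      dotProduct_comm w u]
    linear_combination (u ⬝ᵥ u) * h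
  rw [div_eq_inv_mul, mul_smul, ← sub_eq_zero.1 h0, inv_smul_smul₀ hu]

end Planes

namespace IntVec

/-- An integer vector as an element of `ℝ⁵`. -/
def toReal (u : IntVec) : Fin 5 → ℝ := ![u.1, u.2.1, u.2.2.1, u.2.2.2.1, u.2.2.2.2]

theorem toReal_dotProduct (u v : IntVec) : toReal u ⬝ᵥ toReal v = dot u v := by
  simp [toReal, dot, dotProduct, Fin.sum_univ_five]

theorem toReal_gramDet₂ (u v : IntVec) :
    (toReal u ⬝ᵥ toReal u) * (toReal v ⬝ᵥ toReal v) -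
      (toReal u ⬝ᵥ toReal v) * (toReal u ⬝ᵥ toReal v) = gramDet₂ u v := by
  simp [toReal_dotProduct, gramDet₂]

theorem toReal_mem_plane_iff {Pl : Submodule ℝ (Fin 5 → ℝ)} (hPl : Module.finrank ℝ Pl = 2)
    {u v w : IntVec} (hu : toReal u ∈ Pl) (hv : toReal v ∈ Pl) (huv : gramDet₂ u v ≠ 0) :
    toReal w ∈ Pl ↔ gramDet₃ u v w = 0 := by
  rw [mem_plane_iff_gram_det_eq_zero hPl hu hv (by rw [toReal_gramDet₂]; exact_mod_cast huv),
    toReal_gramDet₂]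
  simp only [toReal_dotProduct, gramDet₃]
  norm_cast

end IntVec

/-- The scalar by which a member of `F5system` differs from its integer direction. -/
def F5scale (Λ M : ℝ) : (({p : Fin 5 × Fin 5 // p.1 < p.2} × Bool) ⊕ Fin 5 ⊕
    {ε : Fin 5 → Bool // ε 0 = true}) → ℝ :=
  Sum.elim (fun _ => 1) (Sum.elim (fun _ => Λ) fun _ => M)

/-- The square of the scale of the members of `F5system` in direction `v`. -/
noncomputable def F5weight (Λ M : ℝ) (v : IntVec) : ℝ :=
  if IntVec.dot v v = 2 then 1 else if IntVec.dot v v = 1 then Λ ^ 2 else M ^ 2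

theorem F5system_eq_smul (Λ M : ℝ) (k) :
    F5system Λ M k = F5scale Λ M k • (F5dir k).toReal := by
  rcases k with ⟨p, b⟩ | i | ε
  · ext t
    fin_cases t <;> simp [F5system, F5scale, F5dir, IntVec.toReal]
  · ext t
    fin_cases t <;> simp [F5system, F5scale, F5dir, IntVec.toReal]
  · ext t
    fin_cases t <;> simp [F5system, F5scale, F5dir, IntVec.toReal]

theorem F5scale_sq (Λ M : ℝ) (k) : F5scale Λ M k ^ 2 = F5weight Λ M (F5dir k) := by
  rcases k with x | i | ε
  · have h : ∀ x, IntVec.dot (F5dir (Sum.inl x)) (F5dir (Sum.inl x)) = 2 := by decide +kernel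
    simp [F5scale, F5weight, h]
  · have h : ∀ x, IntVec.dot (F5dir (Sum.inr (Sum.inl x))) (F5dir (Sum.inr (Sum.inl x))) = 1 := by
      decide +kernel
    simp [F5scale, F5weight, h]
  · have h : ∀ x, IntVec.dot (F5dir (Sum.inr (Sum.inr x))) (F5dir (Sum.inr (Sum.inr x))) = 5 := by
      decide +kernel
    simp [F5scale, F5weight, h]

theorem sum_F5dir {R : Type*} [AddCommMonoid R] (f : IntVec → R) :
    ∑ k, f (F5dir k) = (F5directions.map f).sum := by
  rw [← Multiset.sum_coe, ← Multiset.map_coe, ← map_F5dir_univ, Multiset.map_map]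
  rfl

theorem F5dir_mem (k) : F5dir k ∈ F5directions := by
  rw [← Multiset.mem_coe, ← map_F5dir_univ]
  exact Multiset.mem_map_of_mem _ (Finset.mem_univ k)

theorem gram_F5system (Λ M : ℝ) :
    _root_.gram (F5system Λ M) = (8 + Λ ^ 2 + 16 * M ^ 2) • (1 : Matrix (Fin 5) (Fin 5) ℝ) := by
  ext s t
  have h : _root_.gram (F5system Λ M) s t =
      ∑ k, F5weight Λ M (F5dir k) * ((F5dir k).toReal s * (F5dir k).toReal t) := by
    simp only [_root_.gram, Matrix.sum_apply, vecMulVec_apply, F5system_eq_smul, ← F5scale_sq,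
      Pi.smul_apply, smul_eq_mul]
    exact Finset.sum_congr rfl fun k _ => by ring
  rw [h, sum_F5dir fun v => F5weight Λ M v * (v.toReal s * v.toReal t)]
  fin_cases s <;> fin_cases t <;>
    simp [F5directions, F5weight, IntVec.dot, IntVec.toReal] <;> ring

theorem vee_F5system (Λ M : ℝ) (α : Fin 5 → ℝ) :
    vee (F5system Λ M) α = (8 + Λ ^ 2 + 16 * M ^ 2)⁻¹ • α := by
  have hN : 8 + Λ ^ 2 + 16 * M ^ 2 ≠ 0 := by positivity
  have hinv : (_root_.gram (F5system Λ M))⁻¹ =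
      (8 + Λ ^ 2 + 16 * M ^ 2)⁻¹ • (1 : Matrix (Fin 5) (Fin 5) ℝ) := by
    refine Matrix.inv_eq_right_inv ?_
    rw [gram_F5system, smul_mul_smul_comm, mul_inv_cancel₀ hN, one_smul, one_mul]
  rw [vee, hinv, smul_mulVec, one_mulVec]

theorem F5system_mem_iff {Λ M : ℝ} {k} (hk : F5scale Λ M k ≠ 0)
    (Pl : Submodule ℝ (Fin 5 → ℝ)) : F5system Λ M k ∈ Pl ↔ (F5dir k).toReal ∈ Pl := by
  rw [F5system_eq_smul, Submodule.smul_mem_iff _ hk]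

theorem exists_vee_sum_eq_iff {Λ M : ℝ} (Pl : Submodule ℝ (Fin 5 → ℝ)) {i}
    (hi : F5scale Λ M i ≠ 0) :
    (∃ lam : ℝ, ∑ j ∈ Finset.univ.filter (fun j => F5system Λ M j ∈ Pl),
        (F5system Λ M j ⬝ᵥ vee (F5system Λ M) (F5system Λ M i)) • vee (F5system Λ M)
          (F5system Λ M j) = lam • vee (F5system Λ M) (F5system Λ M i)) ↔
      ∃ lam : ℝ, ((F5directions.filter fun w => w.toReal ∈ Pl).map fun w =>
        (F5weight Λ M w * IntVec.dot w (F5dir i)) • w.toReal).sum = lam • (F5dir i).toReal := by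
  have hN : 8 + Λ ^ 2 + 16 * M ^ 2 ≠ 0 := by positivity
  have hsum : ∑ j ∈ Finset.univ.filter (fun j => F5system Λ M j ∈ Pl),
      (F5system Λ M j ⬝ᵥ vee (F5system Λ M) (F5system Λ M i)) • vee (F5system Λ M)
        (F5system Λ M j) =
      (F5scale Λ M i * ((8 + Λ ^ 2 + 16 * M ^ 2)⁻¹ * (8 + Λ ^ 2 + 16 * M ^ 2)⁻¹)) •
        ((F5directions.filter fun w => w.toReal ∈ Pl).map fun w =>
          (F5weight Λ M w * IntVec.dot w (F5dir i)) • w.toReal).sum := by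
    have hfilter := List.sum_map_ite (fun w : IntVec => w.toReal ∈ Pl)
      (fun w => (F5weight Λ M w * IntVec.dot w (F5dir i)) • w.toReal) (fun _ => 0) F5directions
    rw [List.map_const', List.sum_replicate, smul_zero, add_zero] at hfilter
    rw [← hfilter, ← sum_F5dir fun w => if w.toReal ∈ Pl then
      (F5weight Λ M w * IntVec.dot w (F5dir i)) • w.toReal else 0, Finset.sum_filter, Finset.smul_sum]
    refine Finset.sum_congr rfl fun j _ => ?_
    by_cases hj : F5scale Λ M j = 0
    · simp [F5system_eq_smul, ← F5scale_sq, hj, vee_F5system]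
    · simp only [F5system_mem_iff hj]
      split_ifs
      · simp only [vee_F5system, F5system_eq_smul, dotProduct_smul, smul_dotProduct, smul_smul,
          smul_eq_mul, IntVec.toReal_dotProduct, ← F5scale_sq]
        congr 1
        ring
      · simp
  rw [hsum, vee_F5system, F5system_eq_smul]
  constructor
  · rintro ⟨lam, h⟩
    refine ⟨lam * (8 + Λ ^ 2 + 16 * M ^ 2), ?_⟩
    rw [← inv_smul_smul₀ (mul_ne_zero hi (mul_ne_zero (inv_ne_zero hN) (inv_ne_zero hN)))
      (List.sum _), h, smul_smul, smul_smul, smul_smul]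
    congr 1
    field_simp
  · rintro ⟨lam, h⟩
    refine ⟨lam * (8 + Λ ^ 2 + 16 * M ^ 2)⁻¹, ?_⟩
    rw [h, smul_smul, smul_smul, smul_smul]
    congr 1
    ring

theorem list_sum_dotProduct {ι : Type*} (l : List ι) (f : ι → Fin 5 → ℝ) (v : Fin 5 → ℝ) :
    (l.map f).sum ⬝ᵥ v = (l.map fun x => f x ⬝ᵥ v).sum := by
  induction l with
  | nil => simp
  | cons a l ih => simp [add_dotProduct, ih]

theorem exists_direction_sum_eq_iff {Λ M : ℝ} {Pl : Submodule ℝ (Fin 5 → ℝ)}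
    (hPl : Module.finrank ℝ Pl = 2) {u v : IntVec} (hu : u.toReal ∈ Pl) (hv : v.toReal ∈ Pl)
    (huv : IntVec.gramDet₂ u v ≠ 0) :
    (∃ lam : ℝ, ((F5directions.filter fun w => w.toReal ∈ Pl).map fun w =>
        (F5weight Λ M w * IntVec.dot w u) • w.toReal).sum = lam • u.toReal) ↔
      ((F5directions.filter fun w => IntVec.gramDet₃ u v w = 0).map fun w =>
        F5weight Λ M w * IntVec.defect u v w).sum = 0 := by
  have hmem : ((F5directions.filter fun w => w.toReal ∈ Pl).map fun w =>
      (F5weight Λ M w * IntVec.dot w u) • w.toReal).sum ∈ Pl := by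
    refine list_sum_mem fun x hx => ?_
    obtain ⟨w, hw, rfl⟩ := List.mem_map.1 hx
    exact Pl.smul_mem _ (by simpa using (List.mem_filter.1 hw).2)
  rw [exists_eq_smul_iff_of_mem_plane hPl hu hv hmem
    (by rw [IntVec.toReal_gramDet₂]; exact_mod_cast huv)]
  simp only [IntVec.toReal_mem_plane_iff hPl hu hv huv, list_sum_dotProduct, smul_dotProduct,
    IntVec.toReal_dotProduct, smul_eq_mul, ← List.sum_map_mul_left]
  simp only [← Multiset.sum_coe, ← Multiset.map_coe, ← Multiset.sum_map_sub]
  refine Eq.congr (congrArg Multiset.sum (Multiset.map_congr rfl fun w _ => ?_)) rfl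
  simp only [IntVec.defect]
  push_cast
  ring

theorem exists_direction_sum_eq_of_parallel {Λ M : ℝ} {Pl : Submodule ℝ (Fin 5 → ℝ)}
    {u : IntVec} (hu : IntVec.dot u u ≠ 0)
    (h : ∀ w ∈ F5directions, w.toReal ∈ Pl → IntVec.gramDet₂ u w = 0) :
    ∃ lam : ℝ, ((F5directions.filter fun w => w.toReal ∈ Pl).map fun w =>
      (F5weight Λ M w * IntVec.dot w u) • w.toReal).sum = lam • u.toReal := by
  simp only [eq_comm (b := _ • u.toReal), ← Submodule.mem_span_singleton]
  refine list_sum_mem fun x hx => ?_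
  obtain ⟨w, hw, rfl⟩ := List.mem_map.1 hx
  obtain ⟨hw, hwPl⟩ := List.mem_filter.1 hw
  refine Submodule.smul_mem _ _
    (Submodule.mem_span_singleton.2 ⟨_, (eq_smul_of_gram_det_eq_zero ?_ ?_).symm⟩)
  · rw [IntVec.toReal_dotProduct]
    exact_mod_cast hu
  · rw [IntVec.toReal_gramDet₂, h w hw (by simpa using hwPl), Int.cast_zero]

theorem F5system_span_eq_top (Λ M : ℝ) :
    Submodule.span ℝ (Set.range (F5system Λ M)) = ⊤ := by
  refine eq_top_iff.2 fun x _ => ?_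
  have h := gram_F5system Λ M
  have hN : 8 + Λ ^ 2 + 16 * M ^ 2 ≠ 0 := by positivity
  have hx : x = (8 + Λ ^ 2 + 16 * M ^ 2)⁻¹ • (_root_.gram (F5system Λ M) *ᵥ x) := by
    rw [h, smul_mulVec, one_mulVec, inv_smul_smul₀ hN]
  rw [hx]
  refine Submodule.smul_mem _ _ ?_
  rw [_root_.gram, Matrix.sum_mulVec]
  refine Submodule.sum_mem _ fun k _ => ?_
  rw [Matrix.vecMulVec_mulVec]
  have hk := Submodule.subset_span (R := ℝ) (Set.mem_range_self (f := F5system Λ M) k)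
  simpa [mul_comm] using Submodule.smul_mem _ (F5system Λ M k ⬝ᵥ x) hk

theorem IsVeeSystem.sum_weight_mul_defect_eq_zero {Λ M : ℝ} (h : IsVeeSystem (F5system Λ M))
    {i} (hi : F5scale Λ M i ≠ 0) {v : IntVec} (hv : IntVec.gramDet₂ (F5dir i) v ≠ 0) :
    ((F5directions.filter fun w => IntVec.gramDet₃ (F5dir i) v w = 0).map fun w =>
      F5weight Λ M w * IntVec.defect (F5dir i) v w).sum = 0 := by
  have hPl := finrank_span_pair_of_gram_det_ne_zero (u := (F5dir i).toReal) (v := v.toReal)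
    (by rw [IntVec.toReal_gramDet₂]; exact_mod_cast hv)
  have hu : (F5dir i).toReal ∈ Submodule.span ℝ {(F5dir i).toReal, v.toReal} :=
    Submodule.subset_span (by simp)
  have hvPl : v.toReal ∈ Submodule.span ℝ {(F5dir i).toReal, v.toReal} :=
    Submodule.subset_span (by simp)
  exact (exists_direction_sum_eq_iff hPl hu hvPl hv).1 ((exists_vee_sum_eq_iff _ hi).1
    (h.2.2 _ hPl i ((F5system_mem_iff hi _).2 hu)))

theorem isVeeSystem_F5system {Λ M : ℝ} (hM : M ^ 2 = 1) (hΛ : Λ ^ 2 = 6) :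
    IsVeeSystem (F5system Λ M) := by
  refine ⟨F5system_span_eq_top Λ M, ?_, fun Pl hPl i hi => ?_⟩
  · rw [gram_F5system, Matrix.isUnit_iff_isUnit_det, Matrix.det_smul, Matrix.det_one, mul_one]
    exact (pow_ne_zero _ (by positivity)).isUnit
  have hw : ∀ w, F5weight Λ M w = ((if IntVec.dot w w = 1 then 6 else 1 : ℤ) : ℝ) := by
    intro w
    unfold F5weight
    split_ifs with h1 h2 <;> simp_all
  have hscale : F5scale Λ M i ≠ 0 := by
    rw [← sq_pos_iff, F5scale_sq, hw]
    split_ifs <;> simp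
  rw [exists_vee_sum_eq_iff Pl hscale]
  rw [F5system_mem_iff hscale] at hi
  by_cases h : ∀ w ∈ F5directions, w.toReal ∈ Pl → IntVec.gramDet₂ (F5dir i) w = 0
  · have hdot : ∀ u ∈ F5directions, IntVec.dot u u ≠ 0 := by decide
    exact exists_direction_sum_eq_of_parallel (hdot _ (F5dir_mem i)) h
  · push Not at h
    obtain ⟨v, hv, hvPl, huv⟩ := h
    rw [exists_direction_sum_eq_iff hPl hi hvPl huv]
    have := congrArg (Int.cast : ℤ → ℝ) (F5directions_sum_defect_eq_zero _ (F5dir_mem i) v hv huv)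
    simpa only [hw, ← Int.cast_mul, Int.cast_list_sum, List.map_map, Function.comp_def,
      Int.cast_zero] using this

/-- for `M ≠ 0`, the set `{e_i ± e_j, Λe_i, M(e_1 ± e_2 ± e_3 ± e_4 ± e_5)}`
in `ℝ⁵` is a ∨-system if and only if `M² = 1` and `Λ² = 6`. -/
theorem F5system_isVeeSystem_iff (Λ M : ℝ) (hM : M ≠ 0) :
    IsVeeSystem (F5system Λ M) ↔ (M ^ 2 = 1 ∧ Λ ^ 2 = 6) := by
  refine ⟨fun h => ?_, fun h => isVeeSystem_F5system h.1 h.2⟩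
  let i : (({p : Fin 5 × Fin 5 // p.1 < p.2} × Bool) ⊕ Fin 5 ⊕
      {ε : Fin 5 → Bool // ε 0 = true}) := Sum.inr (Sum.inr ⟨fun _ => true, rfl⟩)
  have hdir : F5dir i = (1, 1, 1, 1, 1) := rfl
  have hi : F5scale Λ M i ≠ 0 := hM
  have hr := h.sum_weight_mul_defect_eq_zero hi (v := (1, 1, 0, 0, 0)) (by decide)
  have hs := h.sum_weight_mul_defect_eq_zero hi (v := (1, 0, 0, 0, 0)) (by decide)
  have fr : (F5directions.filter fun w => IntVec.gramDet₃ (1, 1, 1, 1, 1) (1, 1, 0, 0, 0) w = 0) =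
      [(1, 1, 0, 0, 0), (1, 1, 1, 1, 1), (1, 1, -1, -1, -1)] := by decide +kernel
  have fs : (F5directions.filter fun w => IntVec.gramDet₃ (1, 1, 1, 1, 1) (1, 0, 0, 0, 0) w = 0) =
      [(1, 0, 0, 0, 0), (1, 1, 1, 1, 1), (1, -1, -1, -1, -1)] := by decide +kernel
  rw [hdir, fr] at hr
  rw [hdir, fs] at hs
  norm_num [F5weight, IntVec.dot, IntVec.defect] at hr hs
  constructor <;> linarith
end

section
/- The set {e_i ± e_j (1 ≤ i < j ≤ 6), Λe_i (1 ≤ i ≤ 6), M(e_1 ± e_2 ± … ± e_6) (all sign choices)} in ℝ⁶ with M ≠ 0 is a ∨-system if and only if Λ² = 4 and M² = 1/2. -/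
open Matrix
open scoped Classical

/-- The `F₆`-type family: covectors `e_i ± e_j` (`1 ≤ i < j ≤ 6`), `Λ e_i`
(`1 ≤ i ≤ 6`), and `M(e_1 ± e_2 ± ⋯ ± e_6)` (all sign choices, taken up to overall
sign by fixing the sign of `e_1` to be `+`). -/
def F6system (Λ M : ℝ) :
    (({p : Fin 6 × Fin 6 // p.1 < p.2} × Bool) ⊕ Fin 6 ⊕
      {ε : Fin 6 → Bool // ε 0 = true}) → Fin 6 → ℝ :=
  fun k => match k with
  | Sum.inl (p, b) => fun t =>
      (if t = p.1.1 then 1 else 0) + (if t = p.1.2 then (if b then 1 else -1) else 0)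
  | Sum.inr (Sum.inl i) => fun t => if t = i then Λ else 0
  | Sum.inr (Sum.inr ε) => fun t => M * (if ε.1 t then 1 else -1)

/-- The index type of `F6system`. -/
abbrev F6Index := ({p : Fin 6 × Fin 6 // p.1 < p.2} × Bool) ⊕ Fin 6 ⊕
  {ε : Fin 6 → Bool // ε 0 = true}

namespace F6Index

/-- Unlike the default instance, this one compares sign functions pointwise without rewriting
along the resulting equality, so that it reduces in the kernel. -/
instance instDecidableEq : DecidableEq F6Index
  | Sum.inl p, Sum.inl q =>
    decidable_of_iff (p.1.1.1 = q.1.1.1 ∧ p.1.1.2 = q.1.1.2 ∧ p.2 = q.2)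
      (by simp [Prod.ext_iff, Subtype.ext_iff, and_assoc])
  | Sum.inr (Sum.inl i), Sum.inr (Sum.inl j) => decidable_of_iff (i = j) (by simp)
  | Sum.inr (Sum.inr ε), Sum.inr (Sum.inr δ) =>
    decidable_of_iff (ε.1 1 = δ.1 1 ∧ ε.1 2 = δ.1 2 ∧ ε.1 3 = δ.1 3 ∧ ε.1 4 = δ.1 4 ∧ ε.1 5 = δ.1 5)
      (by simp [Subtype.ext_iff, funext_iff, Fin.forall_fin_succ, ε.2, δ.2])
  | Sum.inl _, Sum.inr _ => isFalse (by simp)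
  | Sum.inr _, Sum.inl _ => isFalse (by simp)
  | Sum.inr (Sum.inl _), Sum.inr (Sum.inr _) => isFalse (by simp)
  | Sum.inr (Sum.inr _), Sum.inr (Sum.inl _) => isFalse (by simp)

/-- The integer vectors underlying `F6system`. -/
def vec : F6Index → Fin 6 → ℤ
  | Sum.inl (p, b) => fun t =>
      (if t = p.1.1 then 1 else 0) + (if t = p.1.2 then (if b then 1 else -1) else 0)
  | Sum.inr (Sum.inl i) => fun t => if t = i then 1 else 0
  | Sum.inr (Sum.inr ε) => fun t => if ε.1 t then 1 else -1

/-- The scalar by which `vec` is multiplied in `F6system`. -/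
def coef (Λ M : ℝ) : F6Index → ℝ
  | Sum.inl _ => 1
  | Sum.inr (Sum.inl _) => Λ
  | Sum.inr (Sum.inr _) => M

/-- Twice the squared coefficient when `Λ ^ 2 = 4` and `M ^ 2 = 1 / 2`. -/
def weight : F6Index → ℤ
  | Sum.inl _ => 2
  | Sum.inr (Sum.inl _) => 8
  | Sum.inr (Sum.inr _) => 1

/-- The standard integer inner product, unfolded. -/
def dot (x y : Fin 6 → ℤ) : ℤ :=
  x 0 * y 0 + x 1 * y 1 + x 2 * y 2 + x 3 * y 3 + x 4 * y 4 + x 5 * y 5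

/-- The first nonzero coordinate of `x`. -/
def first (x : Fin 6 → ℤ) : Fin 6 :=
  if x 0 ≠ 0 then 0 else if x 1 ≠ 0 then 1 else if x 2 ≠ 0 then 2 else
  if x 3 ≠ 0 then 3 else if x 4 ≠ 0 then 4 else 5

/-- The last nonzero coordinate of `x`. -/
def last (x : Fin 6 → ℤ) : Fin 6 :=
  if x 5 ≠ 0 then 5 else if x 4 ≠ 0 then 4 else if x 3 ≠ 0 then 3 else
  if x 2 ≠ 0 then 2 else if x 1 ≠ 0 then 1 else 0

/-- The index of the vector proportional to `x`, for `x` proportional to some `e_i` or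
`e_i ± e_j`. -/
def ofRoot (x : Fin 6 → ℤ) : F6Index :=
  let p := first x
  let q := last x
  if h : p < q then Sum.inl (⟨(p, q), h⟩, decide (0 < x p * x q)) else Sum.inr (Sum.inl p)

/-- The index of the vector proportional to `x`, for `x` proportional to a spinor weight. -/
def ofSpinor (x : Fin 6 → ℤ) : F6Index :=
  Sum.inr (Sum.inr ⟨fun t => decide (0 ≤ x t * x 0), by simpa using mul_self_nonneg (x 0)⟩)

/-- The involution of the system attached to the index `i`: the reflection in `vec i`, up to
sign, if `vec i` is a root of `B₆`; for a spinor weight `vec i`, it pairs the root `β` with the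
reflection of `vec i` in `β`, and fixes `vec i` and all vectors orthogonal to it. -/
def partner (i j : F6Index) : F6Index :=
  let d := dot (vec i) (vec j)
  if d = 0 ∨ i = j then j else
  match i, j with
  | Sum.inr (Sum.inr _), Sum.inr (Sum.inr _) =>
      if 0 < d then ofRoot (fun t => vec i t - vec j t) else ofRoot (fun t => vec i t + vec j t)
  | Sum.inr (Sum.inr _), _ => ofSpinor (fun t => dot (vec j) (vec j) * vec i t - 2 * d * vec j t)
  | _, Sum.inr (Sum.inr _) => ofSpinor (fun t => dot (vec i) (vec i) * vec j t - 2 * d * vec i t)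
  | _, _ => ofRoot (fun t => dot (vec i) (vec i) * vec j t - 2 * d * vec i t)

/-- Kernel evaluation of the properties of `partner`, in one statement so that the value of
`partner i j` is computed only once. -/
theorem partner_spec : ∀ i j : F6Index,
    (dot (vec i) (vec j) = 0 ∨ i = j) ∨
    partner i (partner i j) = j ∧
    (dot (vec (partner i j)) (vec i) ≠ 0) ∧
    ∀ t, dot (vec i) (vec i) * (weight j * dot (vec j) (vec i) * vec j t +
        weight (partner i j) * dot (vec (partner i j)) (vec i) * vec (partner i j) t) =
      (weight j * (dot (vec j) (vec i) * dot (vec j) (vec i)) + weight (partner i j) *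
        (dot (vec (partner i j)) (vec i) * dot (vec (partner i j)) (vec i))) * vec i t := by
  decide +kernel

end F6Index

section Family

variable {n : ℕ} {ι : Type*} [Fintype ι] {A : ι → Fin n → ℝ}

theorem gram_mulVec (A : ι → Fin n → ℝ) (x : Fin n → ℝ) :
    gram A *ᵥ x = ∑ i, (A i ⬝ᵥ x) • A i := by
  simp [_root_.gram, Matrix.sum_mulVec, vecMulVec_mulVec]

theorem span_eq_top_of_gram {c : ℝ} (hc : c ≠ 0) (hG : gram A = c • 1) :
    Submodule.span ℝ (Set.range A) = ⊤ := by
  refine Submodule.eq_top_iff'.2 fun x => ?_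
  have hx : x = c⁻¹ • ∑ i, (A i ⬝ᵥ x) • A i := by
    rw [← gram_mulVec, hG, smul_mulVec, one_mulVec, inv_smul_smul₀ hc]
  rw [hx]
  exact Submodule.smul_mem _ _ <| Submodule.sum_mem _ fun i _ =>
    Submodule.smul_mem _ _ <| Submodule.subset_span ⟨i, rfl⟩

theorem vee_of_gram {c : ℝ} (hG : gram A = c • 1) (hc : c ≠ 0) (α : Fin n → ℝ) :
    vee A α = c⁻¹ • α := by
  have : (gram A)⁻¹ = c⁻¹ • (1 : Matrix (Fin n) (Fin n) ℝ) :=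
    Matrix.inv_eq_left_inv (by rw [hG]; simp [smul_smul, hc])
  rw [vee, this, smul_mulVec, one_mulVec]

/-- If the Gram form is a nonzero multiple of the Euclidean form, the ∨-conditions can be
checked with respect to the Euclidean form. -/
theorem isVeeSystem_iff_of_gram {c : ℝ} (hc : c ≠ 0) (hG : gram A = c • 1) :
    IsVeeSystem A ↔ ∀ Pl : Submodule ℝ (Fin n → ℝ), Module.finrank ℝ Pl = 2 →
      ∀ i, A i ∈ Pl → ∃ lam : ℝ,
        ∑ j ∈ Finset.univ.filter (fun j => A j ∈ Pl), (A j ⬝ᵥ A i) • A j = lam • A i := by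
  have hU : IsUnit (gram A) := by
    rw [hG]
    exact (Matrix.isUnit_iff_isUnit_det _).2 (by simp [hc])
  rw [IsVeeSystem, and_iff_right (span_eq_top_of_gram hc hG), and_iff_right hU]
  refine forall_congr' fun Pl => imp_congr_right fun _ => forall_congr' fun i =>
    imp_congr_right fun _ => ?_
  have key : ∑ j ∈ Finset.univ.filter (fun j => A j ∈ Pl), (A j ⬝ᵥ vee A (A i)) • vee A (A j) =
      (c⁻¹ * c⁻¹) • ∑ j ∈ Finset.univ.filter (fun j => A j ∈ Pl), (A j ⬝ᵥ A i) • A j := by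
    rw [Finset.smul_sum]
    refine Finset.sum_congr rfl fun j _ => ?_
    rw [vee_of_gram hG hc, vee_of_gram hG hc, dotProduct_smul, smul_smul, smul_smul, smul_eq_mul]
    ring_nf
  rw [key, vee_of_gram hG hc]
  constructor
  · rintro ⟨lam, h⟩
    refine ⟨c * lam, ?_⟩
    have h' := congrArg (fun x => (c * c) • x) h
    simp only [smul_smul] at h'
    rw [show c * c * (c⁻¹ * c⁻¹) = 1 by field_simp, one_smul,
      show c * c * (lam * c⁻¹) = c * lam by field_simp] at h'
    exact h'
  · rintro ⟨lam, h⟩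
    exact ⟨c⁻¹ * lam, by rw [h, smul_smul, smul_smul]; ring_nf⟩

/-- If the terms of `∑ j, ⟨A j, A i⟩ A j` can be paired off by an involution `σ` such that
each pair contributes a multiple of `A i`, then the partial sum over any subspace containing
`A i` is a multiple of `A i`. -/
theorem exists_sum_eq_smul_of_involutive {i : ι} {σ : ι → ι} (hσ : Function.Involutive σ)
    (hne : ∀ j, σ j = j ∨ A (σ j) ⬝ᵥ A i ≠ 0)
    (hadd : ∀ j, ∃ z : ℝ, (A j ⬝ᵥ A i) • A j + (A (σ j) ⬝ᵥ A i) • A (σ j) = z • A i)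
    (Pl : Submodule ℝ (Fin n → ℝ)) (hi : A i ∈ Pl) :
    ∃ lam : ℝ,
      ∑ j ∈ Finset.univ.filter (fun j => A j ∈ Pl), (A j ⬝ᵥ A i) • A j = lam • A i := by
  choose z hz using hadd
  have hmem : ∀ j, A j ∈ Pl → A (σ j) ∈ Pl := fun j hj => by
    rcases hne j with h | h
    · rwa [h]
    · rw [← Submodule.smul_mem_iff Pl h, ← add_sub_cancel_left ((A j ⬝ᵥ A i) • A j)
        ((A (σ j) ⬝ᵥ A i) • A (σ j)), hz]
      exact Pl.sub_mem (Pl.smul_mem _ hi) (Pl.smul_mem _ hj)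
  set F := Finset.univ.filter (fun j => A j ∈ Pl)
  have hF : ∀ j ∈ F, σ j ∈ F := fun j hj => by
    simp only [F, Finset.mem_filter, Finset.mem_univ, true_and] at hj ⊢
    exact hmem j hj
  have hsum : ∑ j ∈ F, (A j ⬝ᵥ A i) • A j = ∑ j ∈ F, (A (σ j) ⬝ᵥ A i) • A (σ j) :=
    Finset.sum_nbij' σ σ hF hF (fun j _ => hσ j) (fun j _ => hσ j) fun j _ => by rw [hσ j]
  refine ⟨2⁻¹ * ∑ j ∈ F, z j, ?_⟩
  have h2 : (2 : ℝ) • ∑ j ∈ F, (A j ⬝ᵥ A i) • A j = (∑ j ∈ F, z j) • A i := by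
    rw [two_smul]
    nth_rewrite 2 [hsum]
    rw [← Finset.sum_add_distrib, Finset.sum_smul]
    exact Finset.sum_congr rfl fun j _ => hz j
  rw [mul_smul, ← h2, inv_smul_smul₀ two_ne_zero]

end Family

/-- The subspace of vectors that are constant on the fibres of `b`. -/
def fibrewiseConstant {n : ℕ} (b : Fin n → Bool) : Submodule ℝ (Fin n → ℝ) where
  carrier := {x | ∀ s t, b s = b t → x s = x t}
  add_mem' hx hy s t h := congrArg₂ (· + ·) (hx s t h) (hy s t h)
  zero_mem' _ _ _ := rfl
  smul_mem' c _ hx s t h := congrArg (c * ·) (hx s t h)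

theorem mem_fibrewiseConstant {n : ℕ} {b : Fin n → Bool} {x : Fin n → ℝ} :
    x ∈ fibrewiseConstant b ↔ ∀ s t, b s = b t → x s = x t := Iff.rfl

theorem finrank_fibrewiseConstant {n : ℕ} {b : Fin n → Bool} (hb : Function.Surjective b) :
    Module.finrank ℝ (fibrewiseConstant b) = 2 := by
  let f : (Bool → ℝ) →ₗ[ℝ] (Fin n → ℝ) := LinearMap.funLeft ℝ ℝ b
  have hf : LinearMap.range f = fibrewiseConstant b := by
    ext x
    constructor
    · rintro ⟨y, rfl⟩ s t h
      simp [f, LinearMap.funLeft_apply, h]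
    · intro hx
      refine ⟨fun c => x (Function.surjInv hb c), funext fun t => ?_⟩
      exact hx _ _ (Function.surjInv_eq hb _)
  rw [← hf, LinearMap.finrank_range_of_inj (LinearMap.funLeft_injective_of_surjective ℝ ℝ b hb)]
  simp

namespace F6Index

theorem F6system_apply (Λ M : ℝ) (k : F6Index) (t : Fin 6) :
    F6system Λ M k t = coef Λ M k * vec k t := by
  rcases k with ⟨p, b⟩ | i | ε
  · simp [F6system, coef, vec]
  · simp [F6system, coef, vec]
  · simp [F6system, coef, vec]

theorem F6system_dotProduct (Λ M : ℝ) (j k : F6Index) :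
    F6system Λ M j ⬝ᵥ F6system Λ M k = coef Λ M j * coef Λ M k * dot (vec j) (vec k) := by
  simp only [dotProduct, F6system_apply, Fin.sum_univ_six, dot]
  push_cast
  ring

/-- A sum over the system, weighted by squared coefficients, splits by the type of covector. -/
theorem sum_coef_sq_mul (Λ M : ℝ) (f : F6Index → ℤ) :
    ∑ k, coef Λ M k ^ 2 * (f k : ℝ) =
      ((∑ p, f (Sum.inl p) : ℤ) : ℝ) + Λ ^ 2 * ((∑ i, f (Sum.inr (Sum.inl i)) : ℤ) : ℝ) +
        M ^ 2 * ((∑ ε, f (Sum.inr (Sum.inr ε)) : ℤ) : ℝ) := by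
  rw [Fintype.sum_sum_type, Fintype.sum_sum_type]
  simp [coef, Finset.mul_sum, add_assoc]

theorem sum_vec_mul_vec : ∀ s t : Fin 6,
    ∑ p, vec (Sum.inl p) s * vec (Sum.inl p) t = (if s = t then 10 else 0) ∧
    ∑ i, vec (Sum.inr (Sum.inl i)) s * vec (Sum.inr (Sum.inl i)) t = (if s = t then 1 else 0) ∧
    ∑ ε, vec (Sum.inr (Sum.inr ε)) s * vec (Sum.inr (Sum.inr ε)) t =
      (if s = t then 32 else 0) := by
  decide +kernel

theorem gram_F6system (Λ M : ℝ) :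
    gram (F6system Λ M) = (10 + Λ ^ 2 + 32 * M ^ 2) • 1 := by
  ext s t
  obtain ⟨h₁, h₂, h₃⟩ := sum_vec_mul_vec s t
  have h := sum_coef_sq_mul Λ M (fun k => vec k s * vec k t)
  rw [h₁, h₂, h₃] at h
  calc gram (F6system Λ M) s t
      = ∑ k, coef Λ M k ^ 2 * ((vec k s * vec k t : ℤ) : ℝ) := by
        rw [_root_.gram, Matrix.sum_apply]
        refine Finset.sum_congr rfl fun k _ => ?_
        rw [vecMulVec_apply, F6system_apply, F6system_apply]
        push_cast
        ring
    _ = _ := by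
        rw [h]
        rcases eq_or_ne s t with rfl | hst
        · simp; ring
        · simp [hst]

theorem isVeeSystem_F6system_iff (Λ M : ℝ) :
    IsVeeSystem (F6system Λ M) ↔ ∀ Pl : Submodule ℝ (Fin 6 → ℝ), Module.finrank ℝ Pl = 2 →
      ∀ i, F6system Λ M i ∈ Pl → ∃ lam : ℝ,
        ∑ j ∈ Finset.univ.filter (fun j => F6system Λ M j ∈ Pl),
          (F6system Λ M j ⬝ᵥ F6system Λ M i) • F6system Λ M j = lam • F6system Λ M i :=
  isVeeSystem_iff_of_gram (by positivity) (gram_F6system Λ M)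

/-- The contribution of `j` to the ∨-condition in `fibrewiseConstant b` at the covector
`M(e_1 + ⋯ + e_6)`, with scalar coefficients removed. -/
def planeTerm (b : Fin 6 → Bool) (t : Fin 6) (j : F6Index) : ℤ :=
  if ∀ s t, b s = b t → vec j s = vec j t then dot (vec j) (fun _ => 1) * vec j t else 0

theorem exists_sum_planeTerm {Λ M : ℝ} (hM : M ≠ 0) (h : IsVeeSystem (F6system Λ M))
    {b : Fin 6 → Bool} (hb : Function.Surjective b) :
    ∃ lam : ℝ, ∀ t, ∑ j, coef Λ M j ^ 2 * (planeTerm b t j : ℝ) = lam := by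
  let i : F6Index := Sum.inr (Sum.inr ⟨fun _ => true, rfl⟩)
  have hi : ∀ t, F6system Λ M i t = M := fun t => by simp [i, F6system]
  have hv : vec i = fun _ => 1 := funext fun t => by simp [i, vec]
  have hc : coef Λ M i = M := rfl
  obtain ⟨lam, hlam⟩ := (isVeeSystem_F6system_iff Λ M).1 h (fibrewiseConstant b)
    (finrank_fibrewiseConstant hb) i fun s t _ => by rw [hi, hi]
  refine ⟨lam, fun t => mul_left_cancel₀ hM ?_⟩
  have ht := congrFun hlam t
  rw [Pi.smul_apply, hi, smul_eq_mul, Finset.sum_apply, Finset.sum_filter] at ht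
  rw [mul_comm M lam, ← ht, Finset.mul_sum]
  refine Finset.sum_congr rfl fun j _ => ?_
  rw [Pi.smul_apply, smul_eq_mul, F6system_dotProduct, F6system_apply, hv, hc, planeTerm]
  rcases eq_or_ne (coef Λ M j) 0 with h0 | h0
  · simp [h0]
  · have : F6system Λ M j ∈ fibrewiseConstant b ↔ ∀ s t, b s = b t → vec j s = vec j t := by
      simp only [mem_fibrewiseConstant, F6system_apply, mul_right_inj' h0, Int.cast_inj]
    simp only [this]
    split_ifs
    · push_cast
      ring
    · simp

theorem eq_eight_mul_of_isVeeSystem {Λ M : ℝ} (hM : M ≠ 0) (h : IsVeeSystem (F6system Λ M)) :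
    Λ ^ 2 = 8 * M ^ 2 := by
  obtain ⟨lam, hlam⟩ := exists_sum_planeTerm hM h (b := fun t => decide (t = 0)) (by decide)
  have h0 := hlam 0
  have h1 := hlam 1
  rw [sum_coef_sq_mul] at h0 h1
  rw [show ∑ p, planeTerm (fun t => decide (t = 0)) 0 (Sum.inl p) = 0 by decide +kernel,
    show ∑ i, planeTerm (fun t => decide (t = 0)) 0 (Sum.inr (Sum.inl i)) = 1 by decide +kernel,
    show ∑ ε, planeTerm (fun t => decide (t = 0)) 0 (Sum.inr (Sum.inr ε)) = 2 by
      decide +kernel] at h0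
  rw [show ∑ p, planeTerm (fun t => decide (t = 0)) 1 (Sum.inl p) = 0 by decide +kernel,
    show ∑ i, planeTerm (fun t => decide (t = 0)) 1 (Sum.inr (Sum.inl i)) = 0 by decide +kernel,
    show ∑ ε, planeTerm (fun t => decide (t = 0)) 1 (Sum.inr (Sum.inr ε)) = 10 by
      decide +kernel] at h1
  push_cast at h0 h1
  linarith

theorem eq_half_of_isVeeSystem {Λ M : ℝ} (hM : M ≠ 0) (h : IsVeeSystem (F6system Λ M)) :
    M ^ 2 = 1 / 2 := by
  obtain ⟨lam, hlam⟩ := exists_sum_planeTerm hM h (b := fun t => decide (t < 2)) (by decide)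
  have h0 := hlam 0
  have h2 := hlam 2
  rw [sum_coef_sq_mul] at h0 h2
  rw [show ∑ p, planeTerm (fun t => decide (t < 2)) 0 (Sum.inl p) = 2 by decide +kernel,
    show ∑ i, planeTerm (fun t => decide (t < 2)) 0 (Sum.inr (Sum.inl i)) = 0 by decide +kernel,
    show ∑ ε, planeTerm (fun t => decide (t < 2)) 0 (Sum.inr (Sum.inr ε)) = 4 by
      decide +kernel] at h0
  rw [show ∑ p, planeTerm (fun t => decide (t < 2)) 2 (Sum.inl p) = 0 by decide +kernel,
    show ∑ i, planeTerm (fun t => decide (t < 2)) 2 (Sum.inr (Sum.inl i)) = 0 by decide +kernel,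
    show ∑ ε, planeTerm (fun t => decide (t < 2)) 2 (Sum.inr (Sum.inr ε)) = 8 by
      decide +kernel] at h2
  push_cast at h0 h2
  linarith

theorem dot_comm (x y : Fin 6 → ℤ) : dot x y = dot y x := by
  simp only [dot]
  ring

theorem dot_vec_self_ne_zero : ∀ i : F6Index, dot (vec i) (vec i) ≠ 0 := by
  decide +kernel

theorem partner_of_fixed {i j : F6Index} (h : dot (vec i) (vec j) = 0 ∨ i = j) :
    partner i j = j := if_pos h

theorem partner_partner (i j : F6Index) : partner i (partner i j) = j := by
  rcases partner_spec i j with h | h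
  · rw [partner_of_fixed h, partner_of_fixed h]
  · exact h.1

theorem coef_sq {Λ M : ℝ} (hΛ : Λ ^ 2 = 4) (hM : M ^ 2 = 1 / 2) (k : F6Index) :
    coef Λ M k ^ 2 = weight k / 2 := by
  rcases k with p | i | ε
  · norm_num [coef, weight]
  · norm_num [coef, weight, hΛ]
  · norm_num [coef, weight, hM]

theorem coef_ne_zero {Λ M : ℝ} (hΛ : Λ ^ 2 = 4) (hM : M ^ 2 = 1 / 2) (k : F6Index) :
    coef Λ M k ≠ 0 := by
  have h := coef_sq hΛ hM k
  rintro h0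
  rcases k with p | i | ε <;> norm_num [h0, weight] at h

theorem exists_term_add_term_partner {Λ M : ℝ} (hΛ : Λ ^ 2 = 4) (hM : M ^ 2 = 1 / 2)
    (i j : F6Index) : ∃ z : ℝ,
      (F6system Λ M j ⬝ᵥ F6system Λ M i) • F6system Λ M j +
        (F6system Λ M (partner i j) ⬝ᵥ F6system Λ M i) • F6system Λ M (partner i j) =
      z • F6system Λ M i := by
  rcases partner_spec i j with h | ⟨-, -, h⟩
  · rw [partner_of_fixed h]
    rcases h with h | rfl
    · exact ⟨0, by simp [F6system_dotProduct, dot_comm (vec j), h]⟩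
    · exact ⟨_, (add_smul _ _ _).symm⟩
  · generalize partner i j = k at h ⊢
    have hn : (dot (vec i) (vec i) : ℝ) ≠ 0 := by exact_mod_cast dot_vec_self_ne_zero i
    refine ⟨(weight j * (dot (vec j) (vec i) * dot (vec j) (vec i)) +
      weight k * (dot (vec k) (vec i) * dot (vec k) (vec i))) / 2 / dot (vec i) (vec i),
      funext fun t => ?_⟩
    have ht : (dot (vec i) (vec i) : ℝ) * (weight j * dot (vec j) (vec i) * vec j t +
        weight k * dot (vec k) (vec i) * vec k t) =
      (weight j * (dot (vec j) (vec i) * dot (vec j) (vec i)) +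
        weight k * (dot (vec k) (vec i) * dot (vec k) (vec i))) * vec i t := by
      exact_mod_cast h t
    simp only [Pi.add_apply, Pi.smul_apply, smul_eq_mul, F6system_dotProduct, F6system_apply]
    rw [div_mul_eq_mul_div, eq_div_iff hn]
    linear_combination coef Λ M i / 2 * ht +
      coef Λ M i * dot (vec j) (vec i) * vec j t * dot (vec i) (vec i) * coef_sq hΛ hM j +
      coef Λ M i * dot (vec k) (vec i) * vec k t * dot (vec i) (vec i) * coef_sq hΛ hM k

theorem partner_eq_or_dotProduct_ne_zero {Λ M : ℝ} (hΛ : Λ ^ 2 = 4) (hM : M ^ 2 = 1 / 2)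
    (i j : F6Index) :
    partner i j = j ∨ F6system Λ M (partner i j) ⬝ᵥ F6system Λ M i ≠ 0 := by
  rcases partner_spec i j with h | ⟨-, h, -⟩
  · exact Or.inl (partner_of_fixed h)
  · right
    rw [F6system_dotProduct]
    exact mul_ne_zero (mul_ne_zero (coef_ne_zero hΛ hM _) (coef_ne_zero hΛ hM _))
      (Int.cast_ne_zero.2 h)

end F6Index

/-- for `M ≠ 0`, the set `{e_i ± e_j, Λe_i, M(e_1 ± e_2 ± ⋯ ± e_6)}`
in `ℝ⁶` is a ∨-system if and only if `Λ² = 4` and `M² = 1/2`. -/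
theorem F6system_isVeeSystem_iff (Λ M : ℝ) (hM : M ≠ 0) :
    IsVeeSystem (F6system Λ M) ↔ (Λ ^ 2 = 4 ∧ M ^ 2 = 1 / 2) := by
  constructor
  · intro h
    have hM2 := F6Index.eq_half_of_isVeeSystem hM h
    exact ⟨by linarith [F6Index.eq_eight_mul_of_isVeeSystem hM h], hM2⟩
  · rintro ⟨hΛ, hM2⟩
    rw [F6Index.isVeeSystem_F6system_iff]
    exact fun Pl _ i hi => exists_sum_eq_smul_of_involutive (F6Index.partner_partner i)
      (F6Index.partner_eq_or_dotProduct_ne_zero hΛ hM2 i)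
      (F6Index.exists_term_add_term_partner hΛ hM2 i) Pl hi
end
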